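/- arXiv:1605.05276 — 2 statements merged into one kernel-verified Lean document; each statement's English description precedes it below -/
import Mathlib

section
/- Let X and Y be compact Hausdorff topological spaces and suppose there exists a surjective continuous linear map T : C_p(X) → C_p(Y). If X is totally disconnected, then Y is totally disconnected. -/
/-- `Cp X` is the space of continuous real-valued functions on `X`, as a submodule of
`X → ℝ`; its coercion to a type carries the subspace topology induced from the product
topology on `X → ℝ`, i.e. the topology of pointwise convergence. -/
def Cp (X : Type*) [TopologicalSpace X] : Submodule ℝ (X → ℝ) where
  carrier := {f | Continuous f}
  add_mem' hf hg := hf.add hg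
  zero_mem' := continuous_const
  smul_mem' c f hf := hf.const_smul c

open Set Filter Topology

/-- Pairing with every continuous function gives a function continuous in the parameter, i.e.
the finitely supported measures `a z` depend weak-* continuously on `z`. -/
def WeakStarContinuous {X Z : Type*} [TopologicalSpace X] [TopologicalSpace Z]
    (a : Z → X →₀ ℝ) : Prop :=
  ∀ f : X → ℝ, Continuous f → Continuous fun z => (a z).sum fun x c => c * f x

section Support

variable {X Z : Type*} [TopologicalSpace X] [CompactSpace X] [T2Space X]
  [TotallyDisconnectedSpace X] [TopologicalSpace Z] {a : Z → X →₀ ℝ}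

/-- The support of a weak-* continuous family is lower semicontinuous. -/
theorem WeakStarContinuous.eventually_support_meets (ha : WeakStarContinuous a) {z₀ : Z} {x : X}
    (hx : x ∈ (a z₀).support) {U : Set X} (hU : IsOpen U) (hxU : x ∈ U) :
    ∀ᶠ z in 𝓝 z₀, ∃ x' ∈ (a z).support, x' ∈ U := by
  classical
  have hopen : IsOpen (U \ ((a z₀).support.erase x : Set X)) :=
    hU.sdiff (Finset.finite_toSet _).isClosed
  obtain ⟨V, hV, hxV, hVU⟩ := compact_exists_isClopen_in_isOpen hopen (x := x) ⟨hxU, by simp⟩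
  have hcont := ha (V.indicator fun _ => 1) (hV.continuous_indicator continuous_const)
  have hne : ((a z₀).sum fun x c => c * V.indicator (fun _ => (1 : ℝ)) x) ≠ 0 := by
    rw [Finsupp.sum, Finset.sum_eq_single_of_mem x hx]
    · simpa [hxV] using hx
    · intro y hy hyx
      have : y ∉ V := fun h => (hVU h).2 (by simpa [hyx] using hy)
      simp [this]
  filter_upwards [hcont.continuousAt.eventually_ne hne] with z hz
  obtain ⟨y, hy, hyz⟩ := Finset.exists_ne_zero_of_sum_ne_zero hz
  refine ⟨y, hy, (hVU ?_).1⟩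
  by_contra h
  simp [h] at hyz

theorem WeakStarContinuous.eventually_forall_support_meets (ha : WeakStarContinuous a) (z₀ : Z)
    {U : X → Set X} (hU : ∀ x, x ∈ U x ∧ IsOpen (U x)) :
    ∀ᶠ z in 𝓝 z₀, ∀ x ∈ (a z₀).support, ∃ x' ∈ (a z).support, x' ∈ U x := by
  rw [Filter.eventually_all_finset]
  exact fun x hx => ha.eventually_support_meets hx (hU x).2 (hU x).1

theorem WeakStarContinuous.eventually_card_support_le (ha : WeakStarContinuous a) (z₀ : Z) :
    ∀ᶠ z in 𝓝 z₀, (a z₀).support.card ≤ (a z).support.card := by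
  obtain ⟨U, hU, hdisj⟩ := (a z₀).support.finite_toSet.t2_separation
  filter_upwards [ha.eventually_forall_support_meets z₀ hU] with z hz
  choose! g hg hgU using hz
  refine Finset.card_le_card_of_injOn g hg fun x hx y hy hxy => ?_
  exact hdisj.elim_set hx hy (g x) (hgU x hx) (hxy ▸ hgU y hy)

theorem WeakStarContinuous.isClosed_card_support_le (ha : WeakStarContinuous a) (n : ℕ) :
    IsClosed {z | (a z).support.card ≤ n} := by
  rw [← isOpen_compl_iff, isOpen_iff_mem_nhds]
  intro z₀ hz₀
  filter_upwards [ha.eventually_card_support_le z₀] with z hz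
  simp only [mem_compl_iff, mem_ofPred_eq] at hz₀ ⊢
  omega

/-- Where all supports have the same cardinality, a support missing a closed set also misses it
for nearby parameters. -/
theorem WeakStarContinuous.eventually_support_misses (ha : WeakStarContinuous a) {n : ℕ}
    (hn : ∀ z, (a z).support.card = n) {z₀ : Z} {C : Set X} (hC : IsClosed C)
    (hz₀ : ∀ x ∈ (a z₀).support, x ∉ C) :
    ∀ᶠ z in 𝓝 z₀, ∀ x ∈ (a z).support, x ∉ C := by
  classical
  obtain ⟨U, hU, hdisj⟩ := (a z₀).support.finite_toSet.t2_separation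
  have hmeets : ∀ᶠ z in 𝓝 z₀, ∀ x ∈ (a z₀).support, ∃ x' ∈ (a z).support, x' ∈ U x \ C := by
    rw [Filter.eventually_all_finset]
    exact fun x hx =>
      ha.eventually_support_meets hx ((hU x).2.sdiff hC) ⟨(hU x).1, hz₀ x hx⟩
  filter_upwards [hmeets] with z hz
  choose! g hg hgU using hz
  have hinj : Set.InjOn g (a z₀).support := fun x hx y hy hxy =>
    hdisj.elim_set hx hy (g x) (hgU x hx).1 (hxy ▸ (hgU y hy).1)
  have himage : (a z₀).support.image g = (a z).support :=
    Finset.eq_of_subset_of_card_le (Finset.image_subset_iff.2 hg)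
      (by rw [Finset.card_image_of_injOn hinj, hn, hn])
  intro x hx
  rw [← himage, Finset.mem_image] at hx
  obtain ⟨y, hy, rfl⟩ := hx
  exact (hgU y hy).2

theorem WeakStarContinuous.support_subset [PreconnectedSpace Z] (ha : WeakStarContinuous a)
    {n : ℕ} (hn : ∀ z, (a z).support.card = n) (z w : Z) :
    (a z).support ⊆ (a w).support := by
  intro x hx
  by_contra hxw
  obtain ⟨V, hV, hxV, hVw⟩ := compact_exists_isClopen_in_isOpen
    ((a w).support.finite_toSet.isClosed.isOpen_compl) (x := x) hxw
  have hclopen : IsClopen {z | ∃ x ∈ (a z).support, x ∈ V} := by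
    refine ⟨?_, isOpen_iff_mem_nhds.2 ?_⟩
    · rw [← isOpen_compl_iff, isOpen_iff_mem_nhds]
      intro z₀ hz₀
      filter_upwards [ha.eventually_support_misses hn hV.isClosed
        fun x hx hxV => hz₀ ⟨x, hx, hxV⟩] with z hz
      rintro ⟨x, hx, hxV⟩
      exact hz x hx hxV
    · rintro z₀ ⟨x, hx, hxV⟩
      exact ha.eventually_support_meets hx hV.isOpen hxV
  have huniv := hclopen.eq_univ ⟨z, x, hx, hxV⟩
  obtain ⟨y, hy, hyV⟩ : w ∈ {z | ∃ x ∈ (a z).support, x ∈ V} := huniv ▸ mem_univ w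
  exact hVw hyV hy

theorem WeakStarContinuous.not_linearIndependent_of_card_support [ConnectedSpace Z] [T1Space Z]
    [Nontrivial Z] (ha : WeakStarContinuous a) {n : ℕ} (hn : ∀ z, (a z).support.card = n) :
    ¬ LinearIndependent ℝ a := by
  classical
  intro hli
  obtain ⟨w⟩ : Nonempty Z := inferInstance
  have hZ : Infinite Z :=
    infinite_univ_iff.1 (isPreconnected_univ.infinite_of_nontrivial nontrivial_univ)
  refine hZ.not_finite (hli.finite_of_le_span_finite a
    ((fun x => Finsupp.single x (1 : ℝ)) '' ((a w).support : Set X)) ?_)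
  rintro _ ⟨z, rfl⟩
  rw [← Finsupp.supported_eq_span_single]
  exact Finset.coe_subset.2 (ha.support_subset hn z w)

end Support

/-- In a connected compact Hausdorff space, proper neighbourhoods are not totally disconnected. -/
theorem not_totallyDisconnectedSpace_of_mem_nhds {Z : Type*} [TopologicalSpace Z] [CompactSpace Z]
    [T2Space Z] [PreconnectedSpace Z] {V : Set Z} (hV : IsClosed V) (hne : V ≠ univ) {z : Z}
    (hz : V ∈ 𝓝 z) : ¬ TotallyDisconnectedSpace V := by
  intro _
  have : CompactSpace V := isCompact_iff_compactSpace.1 hV.isCompact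
  obtain ⟨C, hC, hzC, hCV⟩ := compact_exists_isClopen_in_isOpen
    (isOpen_interior.preimage (continuous_subtype_val (p := (· ∈ V))))
    (x := ⟨z, mem_of_mem_nhds hz⟩) (mem_interior_iff_mem_nhds.2 hz)
  have hclosed : IsClosed ((↑) '' C : Set Z) := hV.isClosedEmbedding_subtypeVal.isClosedMap _ hC.1
  have hopen : IsOpen ((↑) '' C : Set Z) := by
    obtain ⟨W, hW, rfl⟩ := isOpen_induced_iff.1 hC.2
    have : ((↑) '' ((↑) ⁻¹' W : Set V) : Set Z) = W ∩ interior V := by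
      ext y
      constructor
      · rintro ⟨y, hy, rfl⟩
        exact ⟨hy, hCV hy⟩
      · rintro ⟨hy, hyV⟩
        exact ⟨⟨y, interior_subset hyV⟩, hy, rfl⟩
    rw [this]
    exact hW.inter isOpen_interior
  have huniv := IsClopen.eq_univ ⟨hclosed, hopen⟩ ⟨z, _, hzC, rfl⟩
  exact hne (univ_subset_iff.1 (huniv ▸ Subtype.coe_image_subset V C))

theorem WeakStarContinuous.comp {X Z W : Type*} [TopologicalSpace X] [TopologicalSpace Z]
    [TopologicalSpace W] {a : Z → X →₀ ℝ} (ha : WeakStarContinuous a) {g : W → Z}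
    (hg : Continuous g) : WeakStarContinuous (a ∘ g) :=
  fun f hf => (ha f hf).comp hg

theorem WeakStarContinuous.not_linearIndependent {X Z : Type*} [TopologicalSpace X]
    [CompactSpace X] [T2Space X] [TotallyDisconnectedSpace X] [TopologicalSpace Z] [CompactSpace Z]
    [T2Space Z] [ConnectedSpace Z] [Nontrivial Z] {a : Z → X →₀ ℝ} (ha : WeakStarContinuous a) :
    ¬ LinearIndependent ℝ a := by
  classical
  intro hli
  have hex : ∃ n, (interior {z | (a z).support.card ≤ n}).Nonempty :=
    nonempty_interior_of_iUnion_of_closed ha.isClosed_card_support_le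
      (iUnion_eq_univ_iff.2 fun z => ⟨(a z).support.card, le_refl (a z).support.card⟩)
  set n := Nat.find hex with hn
  obtain ⟨z₀, hz₀, hcard⟩ : ∃ z ∈ interior {z | (a z).support.card ≤ n},
      n ≤ (a z).support.card := by
    by_contra! h
    obtain ⟨z, hz⟩ := Nat.find_spec hex
    have hpos : n ≠ 0 := fun h0 => by simpa [h0] using h z hz
    refine Nat.find_min hex (m := n - 1) (by omega) ⟨z, ?_⟩
    refine interior_maximal (fun y hy => ?_) isOpen_interior hz
    have := h y hy
    simp only [mem_ofPred_eq]
    omega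
  have hnhds : {z | (a z).support.card = n} ∈ 𝓝 z₀ := by
    filter_upwards [ha.eventually_card_support_le z₀, mem_interior_iff_mem_nhds.1 hz₀] with z h₁ h₂
    exact le_antisymm h₂ (hcard.trans h₁)
  obtain ⟨w, hw⟩ := exists_ne z₀
  obtain ⟨V, hVz, hV, hVU⟩ := exists_mem_nhds_isClosed_subset
    (inter_mem hnhds (isOpen_compl_singleton.mem_nhds (mem_compl_singleton_iff.2 hw.symm)))
  have hnot := not_totallyDisconnectedSpace_of_mem_nhds hV
    (fun h => (hVU (h ▸ mem_univ w)).2 rfl) hVz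
  rw [totallyDisconnectedSpace_iff_connectedComponent_subsingleton] at hnot
  push Not at hnot
  obtain ⟨v, hv⟩ := hnot
  have := isConnected_iff_connectedSpace.1 (isConnected_connectedComponent (x := v))
  have := hv.coe_sort
  let g : connectedComponent v → Z := fun y => y.1.1
  have hg : Continuous g := continuous_subtype_val.comp continuous_subtype_val
  exact (ha.comp hg).not_linearIndependent_of_card_support (fun y => (hVU y.1.2).1)
    (hli.comp g (Subtype.val_injective.comp Subtype.val_injective))

/-- Evaluation at a point as a linear functional on `Cp X`. -/
def Cp.eval {X : Type*} [TopologicalSpace X] (x : X) : ↥(Cp X) →ₗ[ℝ] ℝ :=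
  (LinearMap.proj x).comp (Cp X).subtype

theorem Cp.continuous_eval {X : Type*} [TopologicalSpace X] (x : X) :
    Continuous (Cp.eval x) :=
  (continuous_apply x).comp continuous_subtype_val

/-- Continuous linear functionals on `Cp X` are linear combinations of evaluations. -/
theorem Cp.exists_linearCombination_eval {X : Type*} [TopologicalSpace X] {φ : ↥(Cp X) →ₗ[ℝ] ℝ}
    (hφ : Continuous φ) : ∃ c : X →₀ ℝ, Finsupp.linearCombination ℝ Cp.eval c = φ := by
  rw [← LinearMap.mem_range, Finsupp.range_linearCombination, LinearMap.mem_span_iff_continuous]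
  convert hφ
  rw [instTopologicalSpaceSubtype, Pi.topologicalSpace, induced_iInf]
  simp only [induced_compose]
  rfl

theorem Cp.linearIndependent_eval {Y : Type*} [TopologicalSpace Y] [CompactSpace Y] [T2Space Y] :
    LinearIndependent ℝ (Cp.eval (X := Y)) := by
  classical
  rw [linearIndependent_iff']
  intro s c hc y hy
  obtain ⟨f, hf₀, hf₁, -⟩ := exists_continuous_zero_one_of_isClosed
    (s.erase y).finite_toSet.isClosed (isClosed_singleton (x := y)) (by simp)
  have := LinearMap.congr_fun hc ⟨f, f.continuous⟩
  rw [LinearMap.sum_apply, Finset.sum_eq_single_of_mem y hy] at this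
  · have h1 : f y = 1 := hf₁ rfl
    simpa [Cp.eval, h1] using this
  · intro x hx hxy
    have h0 : f x = 0 := hf₀ (by simp [hx, hxy])
    simp [Cp.eval, h0]

/-- If there is a surjective continuous linear map `C_p(X) → C_p(Y)` between the function
spaces (with the pointwise convergence topology) of compact Hausdorff spaces `X` and `Y`,
and `X` is totally disconnected, then so is `Y`. -/
theorem stmt0 (X Y : Type) [TopologicalSpace X] [TopologicalSpace Y]
    [CompactSpace X] [T2Space X] [CompactSpace Y] [T2Space Y]
    (T : ↥(Cp X) →L[ℝ] ↥(Cp Y)) (hT : Function.Surjective T)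
    (hX : TotallyDisconnectedSpace X) : TotallyDisconnectedSpace Y := by
  choose a ha using fun y : Y => Cp.exists_linearCombination_eval
    (φ := (Cp.eval y).comp T.toLinearMap) ((Cp.continuous_eval y).comp T.continuous)
  have hcont : WeakStarContinuous a := by
    intro f hf
    have heq : (fun y => (a y).sum fun x c => c * f x) = (T ⟨f, hf⟩ : Y → ℝ) := by
      funext y
      have := LinearMap.congr_fun (ha y) ⟨f, hf⟩
      simpa [Finsupp.linearCombination_apply, Finsupp.sum, LinearMap.sum_apply, Cp.eval] using this
    rw [heq]
    exact (T ⟨f, hf⟩).2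
  have hli : LinearIndependent ℝ a := by
    refine LinearIndependent.of_comp (Finsupp.linearCombination ℝ Cp.eval) ?_
    have heq : Finsupp.linearCombination ℝ Cp.eval ∘ a =
        (LinearMap.lcomp ℝ ℝ T.toLinearMap) ∘ Cp.eval := funext ha
    rw [heq]
    exact Cp.linearIndependent_eval.map' _
      (LinearMap.ker_eq_bot.2 (LinearMap.lcomp_injective_of_surjective _ hT))
  rw [totallyDisconnectedSpace_iff_connectedComponent_subsingleton]
  intro y
  by_contra hy
  rw [not_subsingleton_iff] at hy
  have := isConnected_iff_connectedSpace.1 (isConnected_connectedComponent (x := y))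
  have := hy.coe_sort
  have : CompactSpace (connectedComponent y) :=
    isCompact_iff_compactSpace.1 isClosed_connectedComponent.isCompact
  exact (hcont.comp (continuous_subtype_val (p := (· ∈ connectedComponent y)))
    ).not_linearIndependent (hli.comp _ Subtype.val_injective)
end

section
/- Every continuous map from a locally connected continuum to a Bing compactum is constant. That is, if Z is a nonempty compact connected metrizable space which is locally connected, B is a compact metrizable space each of whose connected components is either a singleton or a hereditarily indecomposable continuum, and φ : Z → B is continuous, then φ is constant. -/
/-- A subcontinuum of a space: a nonempty compact connected subset. -/
def IsSubcontinuum {X : Type*} [TopologicalSpace X] (K : Set X) : Prop :=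
  IsCompact K ∧ IsConnected K

/-- A set `C` is hereditarily indecomposable if for every subcontinuum `K ⊆ C` and all
subcontinua `A, B ⊆ K` with `A ∪ B = K`, one has `A = K` or `B = K`. -/
def HereditarilyIndecomposable {X : Type*} [TopologicalSpace X] (C : Set X) : Prop :=
  ∀ K ⊆ C, IsSubcontinuum K →
    ∀ A ⊆ K, ∀ B ⊆ K, IsSubcontinuum A → IsSubcontinuum B → A ∪ B = K → A = K ∨ B = K

/-- Two intersecting subcontinua of a hereditarily indecomposable set are nested. -/
theorem HereditarilyIndecomposable.subset_or_subset {X : Type*} [TopologicalSpace X] {C A B : Set X}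
    (hC : HereditarilyIndecomposable C) (hA : IsSubcontinuum A) (hB : IsSubcontinuum B)
    (hAC : A ⊆ C) (hBC : B ⊆ C) (h : (A ∩ B).Nonempty) : A ⊆ B ∨ B ⊆ A := by
  rcases hC (A ∪ B) (Set.union_subset hAC hBC) ⟨hA.1.union hB.1, hA.2.union h hB.2⟩
    A Set.subset_union_left B Set.subset_union_right hA hB rfl with h | h
  · exact .inr (Set.union_eq_left.mp h.symm)
  · exact .inl (Set.union_eq_right.mp h.symm)

/-- The connected components of a closed set are closed. -/
theorem IsClosed.connectedComponentIn {X : Type*} [TopologicalSpace X] {F : Set X} {x : X}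
    (hF : IsClosed F) : IsClosed (connectedComponentIn F x) := by
  by_cases hx : x ∈ F
  · exact isClosed_of_closure_subset <|
      isPreconnected_connectedComponentIn.closure.subset_connectedComponentIn
        (subset_closure (mem_connectedComponentIn hx))
        (closure_minimal (connectedComponentIn_subset F x) hF)
  · simp [connectedComponentIn_eq_empty hx]

/-- A preconnected set that is a finite union of closed sets, any two of which are nested or
disjoint, is contained in one of them. -/
theorem IsPreconnected.exists_subset_of_nested_or_disjoint {X : Type*} [TopologicalSpace X]
    {K : Set X} (hK : IsPreconnected K) {S : Set (Set X)} (hS : S.Finite) (hne : S.Nonempty)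
    (hclosed : ∀ s ∈ S, IsClosed s) (hSne : ∀ s ∈ S, (K ∩ s).Nonempty) (hcover : K ⊆ ⋃₀ S)
    (hnested : ∀ s ∈ S, ∀ t ∈ S, (s ∩ t).Nonempty → s ⊆ t ∨ t ⊆ s) : ∃ s ∈ S, K ⊆ s := by
  obtain ⟨T, hT⟩ := hS.exists_maximal hne
  refine ⟨T, hT.prop, fun x hx => ?_⟩
  by_contra hxT
  have key : ∀ s ∈ S, (s ∩ T).Nonempty → s ⊆ T := fun s hs h =>
    (hnested s hs T hT.prop h).elim id (fun h => hT.le_of_ge hs h)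
  have hR : IsClosed (⋃₀ {s ∈ S | ¬ (s ∩ T).Nonempty}) := Set.sUnion_eq_biUnion ▸
    (hS.subset (Set.sep_subset _ _)).isClosed_biUnion fun s hs => hclosed s hs.1
  have hcov : ∀ y ∈ K, y ∉ T → y ∈ ⋃₀ {s ∈ S | ¬ (s ∩ T).Nonempty} := fun y hy hyT => by
    obtain ⟨s, hs, hys⟩ := hcover hy
    exact ⟨s, ⟨hs, fun h => hyT (key s hs h hys)⟩, hys⟩
  obtain ⟨y, -, hyT, s, hs, hys⟩ := isPreconnected_closed_iff.mp hK T _ (hclosed T hT.prop) hR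
    (fun y hy => or_iff_not_imp_left.mpr (hcov y hy)) (hSne T hT.prop) ⟨x, hx, hcov x hx hxT⟩
  exact hs.2 ⟨y, hys, hyT⟩

/-- Every continuous map from a nonempty, compact, connected, metrizable, locally
connected space `Z` to a Bing compactum `B` (a compact metrizable space each of whose
connected components is a singleton or a hereditarily indecomposable continuum) is
constant. -/
theorem stmt11 (Z B : Type) [TopologicalSpace Z] [Nonempty Z] [CompactSpace Z]
    [ConnectedSpace Z] [TopologicalSpace.MetrizableSpace Z] [LocallyConnectedSpace Z]
    [TopologicalSpace B] [CompactSpace B] [TopologicalSpace.MetrizableSpace B]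
    (hB : ∀ b : B, (connectedComponent b).Subsingleton ∨
      HereditarilyIndecomposable (connectedComponent b))
    (φ : Z → B) (hφ : Continuous φ) :
    ∀ z z' : Z, φ z = φ z' := by
  intro z z'
  by_contra hne
  have hHI : HereditarilyIndecomposable (connectedComponent (φ z)) := by
    refine (hB (φ z)).resolve_left fun h => hne (h mem_connectedComponent ?_)
    exact (isPreconnected_range hφ).subset_connectedComponent ⟨z, rfl⟩ ⟨z', rfl⟩
  have hloc : ∀ x : Z, ∃ F ∈ nhds x, IsSubcontinuum F ∧ ¬ (φ z ∈ φ '' F ∧ φ z' ∈ φ '' F) := by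
    intro x
    obtain ⟨N, hN, hNc, hNne⟩ :
        ∃ N ∈ nhds (φ x), IsClosed N ∧ ¬ (φ z ∈ N ∧ φ z' ∈ N) := by
      have h : ∃ c, φ x ≠ c ∧ (c = φ z ∨ c = φ z') := by
        by_cases h : φ x = φ z
        · exact ⟨φ z', h ▸ hne, .inr rfl⟩
        · exact ⟨φ z, h, .inl rfl⟩
      obtain ⟨c, hxc, hc⟩ := h
      obtain ⟨N, hN, hNc, hsub⟩ :=
        exists_mem_nhds_isClosed_subset (isOpen_compl_singleton.mem_nhds (show φ x ∈ {c}ᶜ from hxc))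
      refine ⟨N, hN, hNc, fun ⟨h₁, h₂⟩ => ?_⟩
      rcases hc with rfl | rfl
      · exact hsub h₁ rfl
      · exact hsub h₂ rfl
    have hpre := hφ.continuousAt.preimage_mem_nhds hN
    have himage := Set.image_subset_iff.mpr (connectedComponentIn_subset (φ ⁻¹' N) x)
    exact ⟨connectedComponentIn (φ ⁻¹' N) x, connectedComponentIn_mem_nhds hpre,
      ⟨(hNc.preimage hφ).connectedComponentIn.isCompact,
        isConnected_connectedComponentIn_iff.mpr (mem_of_mem_nhds hpre)⟩,
      fun h => hNne ⟨himage h.1, himage h.2⟩⟩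
  choose F hF hFc hFne using hloc
  have himg : ∀ x, IsSubcontinuum (φ '' F x) := fun x =>
    ⟨(hFc x).1.image hφ, (hFc x).2.image φ hφ.continuousOn⟩
  have hsub : ∀ x, φ '' F x ⊆ connectedComponent (φ z) := fun x =>
    (Set.image_subset_range φ _).trans
      ((isPreconnected_range hφ).subset_connectedComponent ⟨z, rfl⟩)
  obtain ⟨t, ht⟩ := CompactSpace.elim_nhds_subcover F hF
  have hcover : Set.range φ ⊆ ⋃₀ ((fun x => φ '' F x) '' t) := by
    rintro _ ⟨y, rfl⟩
    obtain ⟨x, hx, hy⟩ := Set.mem_iUnion₂.mp (ht.ge (Set.mem_univ y))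
    exact ⟨_, ⟨x, hx, rfl⟩, y, hy, rfl⟩
  obtain ⟨_, ⟨x, -, rfl⟩, hx⟩ := (isPreconnected_range hφ).exists_subset_of_nested_or_disjoint
    (t.finite_toSet.image fun x => φ '' F x)
    (let ⟨s, hs, _⟩ := hcover ⟨z, rfl⟩; ⟨s, hs⟩)
    (Set.forall_mem_image.mpr fun x _ => (himg x).1.isClosed)
    (Set.forall_mem_image.mpr fun x _ => by
      rw [Set.inter_eq_right.mpr (Set.image_subset_range φ _)]
      exact (himg x).2.nonempty)
    hcover
    (Set.forall_mem_image.mpr fun x _ => Set.forall_mem_image.mpr fun y _ =>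
      hHI.subset_or_subset (himg x) (himg y) (hsub x) (hsub y))
  exact hFne x ⟨hx ⟨z, rfl⟩, hx ⟨z', rfl⟩⟩
end
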